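/- Let X be a projective variety and L an ample line bundle on X, with section ring R_L = ⊕_m H⁰(X, L^m) over S_L = Sym H⁰(X, L). Then for every i ≥ 0, T^i(R_L) = ⊕_{m ≥ i} K(L^{m−i}, L, …, L) (with i copies of L after the first entry). -/

import Mathlib

open TensorProduct

/-!
Graded modules over the standard graded polynomial ring `S = K[x₀,…,x_r]`
(more generally, over the symmetric algebra of a `K`-vector space `S₁`),
presented through their graded pieces together with the (commuting) action of the
degree-one part `S₁`.  For a bounded-below ℕ-graded module this data is equivalent
to that of a graded `S`-module.  We honestly construct Kempf's modules
`T⁰(R) = R`, `T¹(R) = ker(R(-1) ⊗ S₁ → R)`, `Tⁱ(R) = T^{i-1}(T¹(R))` and the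
generating degree `dⁱ(R)`.
-/

universe u v

/-- An ℕ-graded module over the symmetric algebra `S = Sym S₁` of the `K`-vector
space `S₁` (e.g. the standard graded polynomial ring `K[x₀,…,x_r]` for
`S₁ = K^{r+1}`), given by its graded pieces and the action of `S₁`. -/
structure GradedModuleData (K : Type u) [Field K] (S1 : Type v)
    [AddCommGroup S1] [Module K S1] where
  /-- the degree-`j` graded piece -/
  piece : ℕ → Type v
  acg : ∀ j, AddCommGroup (piece j)
  mod : ∀ j, Module K (piece j)
  /-- the (bilinear) multiplication by degree-one elements of `S` -/
  smul1 : ∀ j, S1 →ₗ[K] piece j →ₗ[K] piece (j + 1)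
  /-- the actions of any two degree-one elements commute (so the pieces indeed
  assemble into a module over the commutative ring `S`) -/
  smul1_comm : ∀ j (s t : S1) (x : piece j),
    smul1 (j + 1) s (smul1 j t x) = smul1 (j + 1) t (smul1 j s x)

namespace GradedModuleData

attribute [instance] acg mod

variable {K : Type u} [Field K] {S1 : Type v} [AddCommGroup S1] [Module K S1]
variable (M : GradedModuleData K S1)

/-- The multiplication map `M_j ⊗ S₁ → M_{j+1}`. -/
noncomputable def mulMap (j : ℕ) : (M.piece j ⊗[K] S1) →ₗ[K] M.piece (j + 1) :=
  TensorProduct.lift (M.smul1 j).flip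

@[simp] lemma mulMap_tmul (j : ℕ) (x : M.piece j) (s : S1) :
    M.mulMap j (x ⊗ₜ s) = M.smul1 j s x := rfl

lemma mulMap_map_comm (j : ℕ) (t : S1) :
    (M.mulMap (j + 1)).comp
        (TensorProduct.map (M.smul1 j t) (LinearMap.id : S1 →ₗ[K] S1)) =
      (M.smul1 (j + 1) t).comp (M.mulMap j) := by
  apply TensorProduct.ext'
  intro x s
  simp [M.smul1_comm j s t x]

/-- Multiplication by `t ∈ S₁` sends `ker(M_j ⊗ S₁ → M_{j+1})` into
`ker(M_{j+1} ⊗ S₁ → M_{j+2})`. -/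
noncomputable def kerMapFun (j : ℕ) (t : S1) :
    LinearMap.ker (M.mulMap j) →ₗ[K] LinearMap.ker (M.mulMap (j + 1)) :=
  (TensorProduct.map (M.smul1 j t) (LinearMap.id : S1 →ₗ[K] S1)).restrict
    (fun x hx => by
      have h := congrArg (fun (f : (M.piece j ⊗[K] S1) →ₗ[K] M.piece (j + 1 + 1)) => f x)
        (M.mulMap_map_comm j t)
      simp only [LinearMap.comp_apply] at h
      simp only [LinearMap.mem_ker] at hx ⊢
      rw [h, hx, map_zero])

@[simp] lemma kerMapFun_coe (j : ℕ) (t : S1) (x : LinearMap.ker (M.mulMap j)) :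
    (M.kerMapFun j t x : M.piece (j + 1) ⊗[K] S1) =
      TensorProduct.map (M.smul1 j t) (LinearMap.id : S1 →ₗ[K] S1) (x : M.piece j ⊗[K] S1) :=
  rfl

/-- The `S₁`-action on `T¹(M)`, as a bilinear map. -/
noncomputable def kerMap (j : ℕ) :
    S1 →ₗ[K] (LinearMap.ker (M.mulMap j) →ₗ[K] LinearMap.ker (M.mulMap (j + 1))) where
  toFun := M.kerMapFun j
  map_add' t t' := by
    ext x
    have : M.smul1 j (t + t') = M.smul1 j t + M.smul1 j t' := map_add _ _ _
    simp [kerMapFun, LinearMap.restrict_apply, this, TensorProduct.map_add_left]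
  map_smul' c t := by
    ext x
    have : M.smul1 j (c • t) = c • M.smul1 j t := map_smul _ _ _
    simp [kerMapFun, LinearMap.restrict_apply, this, TensorProduct.map_smul_left]

lemma kerMap_comm (j : ℕ) (s t : S1) (x : LinearMap.ker (M.mulMap j)) :
    M.kerMap (j + 1) s (M.kerMap j t x) = M.kerMap (j + 1) t (M.kerMap j s x) := by
  apply Subtype.ext
  show TensorProduct.map (M.smul1 (j + 1) s) LinearMap.id
      (TensorProduct.map (M.smul1 j t) LinearMap.id (x : M.piece j ⊗[K] S1)) = _
  rw [← LinearMap.comp_apply, ← TensorProduct.map_comp]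
  have hc : (M.smul1 (j + 1) s).comp (M.smul1 j t)
      = (M.smul1 (j + 1) t).comp (M.smul1 j s) :=
    LinearMap.ext fun y => M.smul1_comm j s t y
  rw [hc, TensorProduct.map_comp]
  rfl

/-- The graded pieces of `T¹(M) = ker(M(-1) ⊗ S₁ → M)`:
`T¹(M)_j = ker(M_{j-1} ⊗ S₁ → M_j)` (and `T¹(M)_0 = 0`). -/
def TonePiece : ℕ → Type v
  | 0 => PUnit
  | j + 1 => LinearMap.ker (M.mulMap j)

noncomputable instance ToneAcg : ∀ j, AddCommGroup (M.TonePiece j)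
  | 0 => inferInstanceAs (AddCommGroup PUnit)
  | j + 1 => inferInstanceAs (AddCommGroup (LinearMap.ker (M.mulMap j)))

noncomputable instance ToneMod : ∀ j, Module K (M.TonePiece j)
  | 0 => (inferInstance : Module K PUnit.{v + 1})
  | j + 1 => inferInstanceAs (Module K (LinearMap.ker (M.mulMap j)))

noncomputable def ToneSmul : ∀ j, S1 →ₗ[K] (M.TonePiece j →ₗ[K] M.TonePiece (j + 1))
  | 0 => 0
  | j + 1 => M.kerMap j

/-- Kempf's module `T¹(M) = ker(M(-1) ⊗_K S₁ → M)`. -/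
noncomputable def Tone : GradedModuleData K S1 where
  piece := M.TonePiece
  acg := M.ToneAcg
  mod := M.ToneMod
  smul1 := M.ToneSmul
  smul1_comm := by
    intro j s t x
    match j with
    | 0 =>
        show M.kerMap 0 s (M.ToneSmul 0 t x) = M.kerMap 0 t (M.ToneSmul 0 s x)
        have h1 : M.ToneSmul 0 t x = 0 := rfl
        have h2 : M.ToneSmul 0 s x = 0 := rfl
        rw [h1, h2]
        exact (map_zero (M.kerMap 0 s)).trans (map_zero (M.kerMap 0 t)).symm
    | j + 1 => exact M.kerMap_comm j s t x

/-- Kempf's modules `T⁰(M) = M`, `T^{i}(M) = T^{i-1}(T¹(M))`. -/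
noncomputable def Titer : ℕ → GradedModuleData K S1 → GradedModuleData K S1
  | 0, M => M
  | i + 1, M => Titer i M.Tone

/-- `M` is generated (over `S`) by its elements of degree `≤ d`; for a
bounded-below ℕ-graded module this is equivalent to the surjectivity of the
multiplication maps `M_j ⊗ S₁ → M_{j+1}` for all `j ≥ d`. -/
def GeneratedInDegLE (d : ℕ) : Prop :=
  ∀ j : ℕ, d ≤ j → Function.Surjective (M.mulMap j)

/-- `d(M) := min { d | M is generated over S in degrees ≤ d }`. -/
noncomputable def dgen : ℕ := sInf {d : ℕ | M.GeneratedInDegLE d}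

end GradedModuleData

open TensorProduct

/-!
Axiomatized framework for a projective variety `X` over an algebraically closed
field `K`, following §4 of Caucci, "The basepoint-freeness threshold and syzygies
of abelian varieties".  Line bundles, coherent sheaves, cohomology dimensions and
the syzygy property `(N_p)` are primitives; spaces of global sections come with
their (commutative) multiplication maps, from which Kempf's spaces
`K(L₁, …, L_n)` and the section module constructions are honestly built.
-/


/-- Basic data of a projective variety over `K`: line bundles (a commutative group
under tensor product), coherent sheaves, cohomology dimensions, global sections,
and the property `(N_p)`. -/
structure ProjVarietyData (K : Type u) [Field K] [IsAlgClosed K] where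
  /-- isomorphism classes of line bundles on `X`, a commutative group under `⊗` -/
  LineBundle : Type v
  lbCommGroup : CommGroup LineBundle
  IsAmple : LineBundle → Prop
  /-- the line bundle is globally generated (basepoint-free) -/
  IsGloballyGenerated : LineBundle → Prop
  /-- coherent sheaves on `X` (up to isomorphism) -/
  Coh : Type v
  ctensor : Coh → Coh → Coh
  /-- the coherent sheaf underlying a line bundle -/
  sheafOf : LineBundle → Coh
  /-- the kernel bundle `M_L := ker(H⁰(X,L) ⊗ O_X → L)` of the evaluation map of a
  basepoint-free line bundle `L` -/
  kernelBundle : LineBundle → Coh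
  /-- `hdim i F = dim_K H^i(X, F)` -/
  hdim : ℕ → Coh → ℕ
  /-- `Np p L` : `L` satisfies the Green–Lazarsfeld property `(N_p)`: the first `p`
  steps of the minimal graded free resolution of `R_L = ⊕_m H⁰(X, L^m)` over
  `S_L = Sym H⁰(X, L)` are linear; equivalently `Tor_p^{S_L}(R_L, K)_j = 0` for all
  `j ≥ p + 2` -/
  Np : ℕ → LineBundle → Prop
  /-- the space of global sections `H⁰(X, F)` -/
  H0 : Coh → Type v
  h0acg : ∀ F, AddCommGroup (H0 F)
  h0mod : ∀ F, Module K (H0 F)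

attribute [instance] ProjVarietyData.lbCommGroup ProjVarietyData.h0acg
  ProjVarietyData.h0mod

/-- A projective variety together with the multiplication maps of global sections
of line bundles. -/
structure ProjVarietySetup (K : Type u) [Field K] [IsAlgClosed K]
    extends ProjVarietyData K where
  /-- multiplication of global sections `H⁰(M) ⊗ H⁰(N) → H⁰(M ⊗ N)` -/
  lmul : ∀ M N : LineBundle,
    H0 (sheafOf M) →ₗ[K] H0 (sheafOf N) →ₗ[K] H0 (sheafOf (M * N))
  /-- multiplying by two sections of `N` in either order gives the same result -/
  lmul_comm : ∀ (M N : LineBundle) (x : H0 (sheafOf M)) (s t : H0 (sheafOf N)),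
    lmul (M * N) N (lmul M N x s) t = lmul (M * N) N (lmul M N x t) s

namespace ProjVarietySetup

variable {K : Type u} [Field K] [IsAlgClosed K] (A : ProjVarietySetup K)

/-- Transport of global sections along an equality of coherent sheaves. -/
def h0cast : ∀ {F G : A.Coh}, F = G → (A.H0 F ≃ₗ[K] A.H0 G)
  | _, _, rfl => LinearEquiv.refl K _

/-- `n`-th tensor power of a coherent sheaf (with `F^{⊗0} = O_X`). -/
def cpow (F : A.Coh) : ℕ → A.Coh
  | 0 => A.sheafOf 1
  | n + 1 => A.ctensor (cpow F n) F

end ProjVarietySetup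
/-- One level of Kempf's tower of section spaces: for fixed `L` this consists of a
family of vector spaces `V M` (to be thought of as `K(M, L, …, L)` with a fixed
number of copies of `L`) together with multiplication maps
`V M ⊗ H⁰(L) → V (M ⊗ L)` (multiplication of sections in the first entry). -/
structure KFam {K : Type u} [Field K] [IsAlgClosed K] (A : ProjVarietySetup K) where
  V : A.LineBundle → Type v
  acg : ∀ M, AddCommGroup (V M)
  mod : ∀ M, Module K (V M)

attribute [instance] KFam.acg KFam.mod

structure KLevel {K : Type u} [Field K] [IsAlgClosed K] (A : ProjVarietySetup K)
    (L : A.LineBundle) extends KFam A where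
  /-- multiplication by global sections of `L` in the first entry -/
  mul : ∀ M : A.LineBundle, V M →ₗ[K] A.H0 (A.sheafOf L) →ₗ[K] V (M * L)
  /-- multiplying by two sections of `L` in either order agrees -/
  mul_comm' : ∀ (M : A.LineBundle) (x : V M) (s t : A.H0 (A.sheafOf L)),
    mul (M * L) (mul M x s) t = mul (M * L) (mul M x t) s

namespace KLevel

variable {K : Type u} [Field K] [IsAlgClosed K] {A : ProjVarietySetup K}
  {L : A.LineBundle} (T : KLevel A L)

/-- The multiplication map `K(M, L, …, L) ⊗ H⁰(L) → K(M ⊗ L, L, …, L)`. -/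
noncomputable def mulMap (M : A.LineBundle) :
    (T.V M ⊗[K] A.H0 (A.sheafOf L)) →ₗ[K] T.V (M * L) :=
  TensorProduct.lift (T.mul M)

@[simp] lemma mulMap_tmul (M : A.LineBundle) (x : T.V M) (s : A.H0 (A.sheafOf L)) :
    T.mulMap M (x ⊗ₜ s) = T.mul M x s := rfl

lemma mulMap_map_comm (M : A.LineBundle) (t : A.H0 (A.sheafOf L)) :
    (T.mulMap (M * L)).comp
        (TensorProduct.map ((T.mul M).flip t) LinearMap.id) =
      ((T.mul (M * L)).flip t).comp (T.mulMap M) := by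
  apply TensorProduct.ext'
  intro x s
  simp [T.mul_comm' M x s t]

/-- Multiplication by `t ∈ H⁰(L)` sends `ker(V M ⊗ H⁰(L) → V (M⊗L))` to
`ker(V (M⊗L) ⊗ H⁰(L) → V (M⊗L⊗L))`. -/
noncomputable def kerMapFun (M : A.LineBundle) (t : A.H0 (A.sheafOf L)) :
    LinearMap.ker (T.mulMap M) →ₗ[K] LinearMap.ker (T.mulMap (M * L)) :=
  (TensorProduct.map ((T.mul M).flip t) LinearMap.id).restrict
    (fun x hx => by
      have h := congrArg
        (fun (f : (T.V M ⊗[K] A.H0 (A.sheafOf L)) →ₗ[K] T.V (M * L * L)) => f x)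
        (T.mulMap_map_comm M t)
      simp only [LinearMap.comp_apply] at h
      simp only [LinearMap.mem_ker] at hx ⊢
      rw [h, hx, map_zero])

@[simp] lemma kerMapFun_coe (M : A.LineBundle) (t : A.H0 (A.sheafOf L))
    (x : LinearMap.ker (T.mulMap M)) :
    (T.kerMapFun M t x : T.V (M * L) ⊗[K] A.H0 (A.sheafOf L)) =
      TensorProduct.map ((T.mul M).flip t) LinearMap.id
        (x : T.V M ⊗[K] A.H0 (A.sheafOf L)) := rfl

/-- `t ↦ (multiplication by t)`, as a linear map. -/
noncomputable def kerMapL (M : A.LineBundle) :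
    A.H0 (A.sheafOf L) →ₗ[K]
      (LinearMap.ker (T.mulMap M) →ₗ[K] LinearMap.ker (T.mulMap (M * L))) where
  toFun := T.kerMapFun M
  map_add' t t' := by
    apply LinearMap.ext; intro x
    apply Subtype.ext
    show TensorProduct.map ((T.mul M).flip (t + t')) LinearMap.id
      (x : T.V M ⊗[K] A.H0 (A.sheafOf L)) = _
    rw [map_add, TensorProduct.map_add_left]
    rfl
  map_smul' c t := by
    apply LinearMap.ext; intro x
    apply Subtype.ext
    show TensorProduct.map ((T.mul M).flip (c • t)) LinearMap.id
      (x : T.V M ⊗[K] A.H0 (A.sheafOf L)) = _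
    rw [map_smul, TensorProduct.map_smul_left]
    rfl

/-- The induced bilinear multiplication on the next level of the tower. -/
noncomputable def kerMap (M : A.LineBundle) :
    LinearMap.ker (T.mulMap M) →ₗ[K] A.H0 (A.sheafOf L) →ₗ[K]
      LinearMap.ker (T.mulMap (M * L)) :=
  (T.kerMapL M).flip

@[simp] lemma kerMap_coe (M : A.LineBundle) (x : LinearMap.ker (T.mulMap M))
    (t : A.H0 (A.sheafOf L)) :
    (T.kerMap M x t : T.V (M * L) ⊗[K] A.H0 (A.sheafOf L)) =
      TensorProduct.map ((T.mul M).flip t) LinearMap.id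
        (x : T.V M ⊗[K] A.H0 (A.sheafOf L)) := rfl

lemma kerMap_comm (M : A.LineBundle) (x : LinearMap.ker (T.mulMap M))
    (s t : A.H0 (A.sheafOf L)) :
    T.kerMap (M * L) (T.kerMap M x s) t = T.kerMap (M * L) (T.kerMap M x t) s := by
  apply Subtype.ext
  rw [kerMap_coe, kerMap_coe, kerMap_coe, kerMap_coe,
    ← LinearMap.comp_apply, ← TensorProduct.map_comp,
    ← LinearMap.comp_apply (TensorProduct.map _ _), ← TensorProduct.map_comp]
  have hc : ((T.mul (M * L)).flip t).comp ((T.mul M).flip s)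
      = ((T.mul (M * L)).flip s).comp ((T.mul M).flip t) := by
    apply LinearMap.ext
    intro y
    simp only [LinearMap.comp_apply, LinearMap.flip_apply]
    exact T.mul_comm' M y s t
  rw [hc]

/-- The next level of Kempf's tower: `K(M, L, …, L)` with one more copy of `L` is
the kernel of the multiplication map `K(M, L, …, L) ⊗ H⁰(L) → K(M⊗L, L, …, L)`. -/
noncomputable def next : KLevel A L where
  V M := LinearMap.ker (T.mulMap M)
  acg _ := inferInstance
  mod _ := inferInstance
  mul M := T.kerMap M
  mul_comm' := T.kerMap_comm

/-- Transport along an equality of line bundles. -/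
def vcast : ∀ {M N : A.LineBundle}, M = N → (T.V M ≃ₗ[K] T.V N)
  | _, _, rfl => LinearEquiv.refl K _

end KLevel

namespace ProjVarietySetup

variable {K : Type u} [Field K] [IsAlgClosed K] (A : ProjVarietySetup K)

/-- Kempf's tower: `(KTower A L n).V M` is the space `K(M, L, …, L)` with `n`
copies of `L`, defined by `K(M) := H⁰(X, M)` and the exact sequences
`0 → K(M, L, …, L) → K(M, L, …, L) ⊗ H⁰(L) → K(M⊗L, L, …, L)` of Definition 4.1. -/
noncomputable def KTower (L : A.LineBundle) : ℕ → KLevel A L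
  | 0 =>
    { V := fun M => A.H0 (A.sheafOf M)
      acg := fun _ => inferInstance
      mod := fun _ => inferInstance
      mul := fun M => A.lmul M L
      mul_comm' := fun M x s t => A.lmul_comm M L x s t }
  | n + 1 => (KTower L n).next

end ProjVarietySetup
namespace ProjVarietySetup

variable {K : Type u} [Field K] [IsAlgClosed K] (A : ProjVarietySetup K)

lemma lmul_cast_comm {M M' N : A.LineBundle} (h : M * N = M')
    (x : A.H0 (A.sheafOf M)) (s t : A.H0 (A.sheafOf N)) :
    A.lmul M' N (A.h0cast (congrArg A.sheafOf h) (A.lmul M N x s)) t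
      = A.lmul M' N (A.h0cast (congrArg A.sheafOf h) (A.lmul M N x t)) s := by
  subst h
  exact A.lmul_comm M N x s t

/-- The section ring `R_L = ⊕_m H⁰(X, L^m)` of an ample line bundle `L`, as a
graded module over `S_L = Sym H⁰(X, L)` (recorded through its graded pieces and
the multiplication by the degree-one part `S₁ = H⁰(X, L)`). -/
noncomputable def sectionRing (L : A.LineBundle) :
    GradedModuleData K (A.H0 (A.sheafOf L)) where
  piece m := A.H0 (A.sheafOf (L ^ m))
  acg _ := inferInstance
  mod _ := inferInstance
  smul1 m :=
    (A.lmul (L ^ m) L).flip.compr₂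
      (A.h0cast (congrArg A.sheafOf (pow_succ L m).symm)).toLinearMap
  smul1_comm := by
    intro m s t x
    simp only [LinearMap.compr₂_apply, LinearMap.flip_apply, LinearEquiv.coe_coe]
    exact congrArg _ (A.lmul_cast_comm (pow_succ L m).symm x t s)

end ProjVarietySetup

namespace TiterProof

open GradedModuleData

variable {K : Type u} [Field K] [IsAlgClosed K] {A : ProjVarietySetup K}

lemma Titer_succ {S1 : Type v} [AddCommGroup S1] [Module K S1] (i : ℕ) :
    ∀ M : GradedModuleData K S1, Titer (i + 1) M = (Titer i M).Tone := by
  induction i with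
  | zero => intro M; rfl
  | succ i ih => intro M; exact ih M.Tone

/-- `M` agrees with the `K`-spaces of the level `T`, shifted by `i`. -/
def Match {L : A.LineBundle} (i : ℕ) (M : GradedModuleData K (A.H0 (A.sheafOf L)))
    (T : KLevel A L) : Prop :=
  (∀ m : ℕ, m < i → Subsingleton (M.piece m)) ∧
  ∃ e : ∀ m k : ℕ, m = k + i → (M.piece m ≃ₗ[K] T.V (L ^ k)),
    ∀ (m k : ℕ) (h : m = k + i) (h' : m + 1 = k + 1 + i) (s : A.H0 (A.sheafOf L))
      (x : M.piece m),
      e (m + 1) (k + 1) h' (M.smul1 m s x)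
        = T.vcast (pow_succ L k).symm (T.mul (L ^ k) (e m k h x) s)

lemma vcast_next_coe {L : A.LineBundle} (T : KLevel A L) {M N : A.LineBundle} (h : M = N)
    (x : LinearMap.ker (T.mulMap M)) :
    Subtype.val (p := (· ∈ LinearMap.ker (T.mulMap N))) (T.next.vcast h x) =
      TensorProduct.map (T.vcast h).toLinearMap LinearMap.id
        (x : T.V M ⊗[K] A.H0 (A.sheafOf L)) := by
  subst h
  have : (T.vcast (rfl : M = M)).toLinearMap = LinearMap.id := rfl
  rw [this, TensorProduct.map_id]
  rfl

/-- The isomorphism of kernels induced by compatible isomorphisms. -/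
noncomputable def kerEquiv {V V' W W' : Type*} [AddCommGroup V] [AddCommGroup V']
    [AddCommGroup W] [AddCommGroup W'] [Module K V] [Module K V'] [Module K W] [Module K W']
    (f : V →ₗ[K] W) (g : V' →ₗ[K] W') (e : V ≃ₗ[K] V') (e' : W ≃ₗ[K] W')
    (h : ∀ x, e' (f x) = g (e x)) : LinearMap.ker f ≃ₗ[K] LinearMap.ker g :=
  e.ofSubmodules _ _ (by
    ext y
    simp only [Submodule.mem_map, LinearMap.mem_ker]
    constructor
    · rintro ⟨x, hx, rfl⟩
      have := h x
      rw [hx, map_zero] at this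
      exact this.symm
    · intro hy
      refine ⟨e.symm y, ?_, by simp⟩
      apply e'.injective
      rw [h]
      simpa using hy)

lemma kerEquiv_coe {V V' W W' : Type*} [AddCommGroup V] [AddCommGroup V']
    [AddCommGroup W] [AddCommGroup W'] [Module K V] [Module K V'] [Module K W] [Module K W']
    (f : V →ₗ[K] W) (g : V' →ₗ[K] W') (e : V ≃ₗ[K] V') (e' : W ≃ₗ[K] W')
    (h : ∀ x, e' (f x) = g (e x)) (x : LinearMap.ker f) :
    (kerEquiv f g e e' h x : V') = e x := rfl

lemma Match.next {L : A.LineBundle} {i : ℕ} {M : GradedModuleData K (A.H0 (A.sheafOf L))}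
    {T : KLevel A L} (H : Match i M T) : Match (i + 1) M.Tone T.next := by
  obtain ⟨hs, e, he⟩ := H
  refine ⟨?_, ?_⟩
  · intro m hm
    match m, hm with
    | 0, _ => exact (inferInstance : Subsingleton PUnit)
    | m + 1, hm =>
      have := hs m (by omega)
      have : Subsingleton (M.piece m ⊗[K] A.H0 (A.sheafOf L)) := by
        refine subsingleton_of_forall_eq 0 fun x => ?_
        induction x with
        | zero => rfl
        | add x y hx hy => rw [hx, hy, add_zero]
        | tmul x s => rw [Subsingleton.elim x 0, TensorProduct.zero_tmul]
      exact (inferInstance : Subsingleton (LinearMap.ker (M.mulMap m)))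
  · have key : ∀ (m k : ℕ) (h : m = k + i) (x : M.piece m ⊗[K] A.H0 (A.sheafOf L)),
        ((e (m + 1) (k + 1) (by omega)).trans (T.vcast (pow_succ L k).symm).symm)
            (M.mulMap m x)
          = T.mulMap (L ^ k)
            (TensorProduct.congr (e m k h) (LinearEquiv.refl K (A.H0 (A.sheafOf L))) x) := by
      intro m k h x
      induction x with
      | zero => simp only [map_zero]
      | add x y hx hy => simp only [map_add, hx, hy]
      | tmul x s =>
        rw [GradedModuleData.mulMap_tmul, TensorProduct.congr_tmul, KLevel.mulMap_tmul,
          LinearEquiv.trans_apply, he m k h, LinearEquiv.symm_apply_apply]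
        rfl
    let e' : ∀ m k : ℕ, m = k + (i + 1) → (M.Tone.piece m ≃ₗ[K] T.next.V (L ^ k)) :=
      fun m k h => match m, h with
        | 0, h => absurd h (by omega)
        | m + 1, h => kerEquiv (M.mulMap m) (T.mulMap (L ^ k)) _ _ (key m k (by omega))
    refine ⟨e', ?_⟩
    intro m k h h' s x
    match m, h, h', x with
    | 0, h, _, _ => omega
    | m + 1, h, h', x =>
      apply Subtype.ext
      refine Eq.trans ?_ (vcast_next_coe T _ _).symm
      have hm : m = k + i := by omega
      show TensorProduct.map (e (m + 1) (k + 1) (by omega)).toLinearMap LinearMap.id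
          (TensorProduct.map (M.smul1 m s) LinearMap.id
            (Subtype.val (p := (· ∈ LinearMap.ker (M.mulMap m))) x)) =
        TensorProduct.map (T.vcast (pow_succ L k).symm).toLinearMap LinearMap.id
          (TensorProduct.map ((T.mul (L ^ k)).flip s) LinearMap.id
            (TensorProduct.map (e m k hm).toLinearMap LinearMap.id
              (Subtype.val (p := (· ∈ LinearMap.ker (M.mulMap m))) x)))
      generalize (Subtype.val (p := (· ∈ LinearMap.ker (M.mulMap m))) x) = y
      induction y with
      | zero => simp only [map_zero]
      | add x y hx hy => simp only [map_add, hx, hy]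
      | tmul x t =>
        simp only [TensorProduct.map_tmul, LinearEquiv.coe_coe, LinearMap.id_apply,
          LinearMap.flip_apply]
        rw [he m k hm]

lemma h0cast_eq_vcast {L : A.LineBundle} {M N : A.LineBundle} (h : M = N)
    (x : A.H0 (A.sheafOf M)) :
    A.h0cast (congrArg A.sheafOf h) x = (A.KTower L 0).vcast h x := by
  subst h
  rfl

/-- Transport of pieces along an equality of degrees. -/
def pcast {S1 : Type v} [AddCommGroup S1] [Module K S1] (M : GradedModuleData K S1) :
    ∀ {m n : ℕ}, m = n → (M.piece m ≃ₗ[K] M.piece n)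
  | _, _, rfl => LinearEquiv.refl K _

lemma match_zero (L : A.LineBundle) : Match 0 (A.sectionRing L) (A.KTower L 0) := by
  refine ⟨fun m hm => absurd hm (by omega), ?_⟩
  refine ⟨fun m k h => pcast (A.sectionRing L) (h.trans (Nat.add_zero k)), ?_⟩
  intro m k h h' s x
  obtain rfl : m = k := h
  exact h0cast_eq_vcast (L := L) (pow_succ L m).symm (A.lmul (L ^ m) L x s)

lemma match_all (L : A.LineBundle) (i : ℕ) :
    Match i (Titer i (A.sectionRing L)) (A.KTower L i) := by
  induction i with
  | zero => exact match_zero L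
  | succ i ih =>
    rw [Titer_succ]
    exact ih.next

end TiterProof

/-- **Caucci, equation (4.3).**  Let `X` be a projective variety and `L` an ample
line bundle, with section ring `R_L = ⊕_m H⁰(X, L^m)` over `S_L = Sym H⁰(X, L)`.
Then for every `i ≥ 0` one has `Tⁱ(R_L) = ⊕_{m ≥ i} K(L^{m-i}, L, …, L)` (with `i`
copies of `L` after the first entry): the graded pieces of `Tⁱ(R_L)` of degree
`< i` vanish, and in degrees `m ≥ i` there are `K`-linear isomorphisms
with `K(L^{m-i}, L, …, L)` compatible with the multiplication by `S₁ = H⁰(X, L)`. -/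
theorem Titer_sectionRing_eq_Kspaces {K : Type u} [Field K] [IsAlgClosed K]
    (A : ProjVarietySetup K) (L : A.LineBundle) (hample : A.IsAmple L) (i : ℕ) :
    (∀ m : ℕ, m < i →
        Subsingleton ((GradedModuleData.Titer i (A.sectionRing L)).piece m)) ∧
    ∃ e : ∀ m : ℕ, i ≤ m →
        ((GradedModuleData.Titer i (A.sectionRing L)).piece m ≃ₗ[K]
          (A.KTower L i).V (L ^ (m - i))),
      ∀ (m : ℕ) (hm : i ≤ m) (s : A.H0 (A.sheafOf L))
          (x : (GradedModuleData.Titer i (A.sectionRing L)).piece m),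
        e (m + 1) (le_trans hm (Nat.le_succ m))
            ((GradedModuleData.Titer i (A.sectionRing L)).smul1 m s x)
          = (A.KTower L i).vcast
              (show L ^ (m - i) * L = L ^ (m + 1 - i) by
                rw [← pow_succ]; congr 1; omega)
              ((A.KTower L i).mul (L ^ (m - i)) (e m hm x) s) := by
  obtain ⟨hs, e, he⟩ := TiterProof.match_all L i
  refine ⟨hs, fun m hm => e m (m - i) (by omega), ?_⟩
  intro m hm s x
  have gen : ∀ (n : ℕ) (hn : n = m - i + 1) (h1 : m + 1 = n + i)
      (h2 : L ^ (m - i) * L = L ^ n),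
      e (m + 1) n h1 ((GradedModuleData.Titer i (A.sectionRing L)).smul1 m s x)
        = (A.KTower L i).vcast h2
            ((A.KTower L i).mul (L ^ (m - i)) (e m (m - i) (by omega) x) s) := by
    intro n hn h1 h2
    subst hn
    exact he m (m - i) (by omega) h1 s x
  exact gen (m + 1 - i) (by omega) _ _
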